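/- arXiv:1608.02047 — 3 statements merged into one kernel-verified Lean document; each statement's English description precedes it below -/
import Mathlib

section
/- Let A be a complex unital Banach algebra, let κ > 0 be real, let a ∈ A and let r be real with ‖a‖ < r < κ. Then (2πi)^{−1} ∮_{C(κ,r)} Log λ · (λ·1 − a − κ·1)^{−2} · a dλ = 1 − κ (a + κ·1)^{−1}, where (λ·1 − a − κ·1)^{−2} denotes the square of the resolvent (λ·1 − a − κ·1)^{−1} and a + κ·1 is invertible. -/
open Complex Metric Real

/-- Unlike `spectrum.mem_resolventSet_of_norm_lt`, this does not need `NormOneClass`. -/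
theorem mem_resolventSet_of_norm_sub_algebraMap_lt {A : Type*} [NormedRing A] [NormedAlgebra ℂ A]
    [CompleteSpace A] {b : A} {c z : ℂ} (h : ‖b - algebraMap ℂ A c‖ < ‖z - c‖) :
    z ∈ resolventSet ℂ b := by
  have hz : z - c ≠ 0 := norm_pos_iff.1 ((norm_nonneg _).trans_lt h)
  have hu : IsUnit (1 - (z - c)⁻¹ • (b - algebraMap ℂ A c)) := by
    apply isUnit_one_sub_of_norm_lt_one
    rw [norm_smul, norm_inv, inv_mul_lt_one₀ (norm_pos_iff.2 hz)]
    exact h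
  have hmul : algebraMap ℂ A z - b =
      Units.mk0 (z - c) hz • (1 - (z - c)⁻¹ • (b - algebraMap ℂ A c)) := by
    rw [Units.smul_def, Units.val_mk0, smul_sub, smul_inv_smul₀ hz,
      ← Algebra.algebraMap_eq_smul_one, map_sub]
    abel
  rw [spectrum.mem_resolventSet_iff, hmul]
  exact hu.smul _

theorem circleIntegral_sub_center_inv_smul_comp_inv {E : Type*} [NormedAddCommGroup E]
    [NormedSpace ℂ E] (g : ℂ → E) (c : ℂ) {r : ℝ} (hr : r ≠ 0) :
    (∮ z in C(c, r), (z - c)⁻¹ • g (z - c)⁻¹) = ∮ w in C(0, r⁻¹), w⁻¹ • g w := by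
  have hL : ∀ θ : ℝ, deriv (circleMap c r) θ •
      ((circleMap c r θ - c)⁻¹ • g (circleMap c r θ - c)⁻¹) = I • g (circleMap 0 r⁻¹ (-θ)) := by
    intro θ
    have h0 : circleMap 0 r θ ≠ 0 := circleMap_ne_center hr
    have hinv : (circleMap 0 r θ)⁻¹ = circleMap 0 r⁻¹ (-θ) := by
      simp [circleMap, mul_comm, ← Complex.exp_neg]
    rw [deriv_circleMap, circleMap_sub_center, hinv, smul_smul, ← hinv]
    congr 1
    field_simp
  have hR : ∀ θ : ℝ, deriv (circleMap 0 r⁻¹) θ •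
      ((circleMap 0 r⁻¹ θ)⁻¹ • g (circleMap 0 r⁻¹ θ)) = I • g (circleMap 0 r⁻¹ θ) := by
    intro θ
    have h0 : circleMap 0 r⁻¹ θ ≠ 0 := circleMap_ne_center (inv_ne_zero hr)
    rw [deriv_circleMap, smul_smul, mul_right_comm, mul_inv_cancel₀ h0, one_mul]
  have hper : Function.Periodic (fun θ : ℝ => I • g (circleMap 0 r⁻¹ θ)) (2 * π) :=
    (periodic_circleMap 0 r⁻¹).comp fun w => I • g w
  simp only [circleIntegral, hL, hR]
  rw [intervalIntegral.integral_comp_neg fun θ => I • g (circleMap 0 r⁻¹ θ)]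
  simpa using hper.intervalIntegral_add_eq (-(2 * π)) 0

theorem circleIntegral_resolvent {A : Type*} [NormedRing A] [NormedAlgebra ℂ A]
    [CompleteSpace A] {b : A} {c : ℂ} {r : ℝ} (h : ‖b - algebraMap ℂ A c‖ < r) :
    (∮ z in C(c, r), resolvent b z) = (2 * π * I : ℂ) • (1 : A) := by
  have hr : 0 < r := (norm_nonneg _).trans_lt h
  set d := b - algebraMap ℂ A c with hd
  have hg : DifferentiableOn ℂ (fun w : ℂ => Ring.inverse (1 - w • d)) (closedBall 0 r⁻¹) := by
    intro w hw
    have hu : IsUnit (1 - w • d) := by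
      apply isUnit_one_sub_of_norm_lt_one
      rw [norm_smul]
      calc ‖w‖ * ‖d‖ ≤ r⁻¹ * ‖d‖ := by
            gcongr
            simpa using hw
        _ < 1 := by rwa [inv_mul_lt_one₀ hr]
    exact ((differentiableAt_inverse (𝕜 := ℂ) hu).comp w
      (f := fun w : ℂ => 1 - w • d) (by fun_prop)).differentiableWithinAt
  have hres : Set.EqOn (resolvent b) (fun z => (z - c)⁻¹ • Ring.inverse (1 - (z - c)⁻¹ • d))
      (sphere c r) := by
    intro z hz
    have hz' : z - c ≠ 0 := by
      rw [← norm_pos_iff, mem_sphere_iff_norm.1 hz]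
      exact hr
    have hmul : algebraMap ℂ A z - b = algebraMap ℂ A (z - c) * (1 - (z - c)⁻¹ • d) := by
      rw [← Algebra.smul_def, smul_sub, smul_inv_smul₀ hz', ← Algebra.algebraMap_eq_smul_one,
        map_sub, hd]
      abel
    have hunit : IsUnit (algebraMap ℂ A (z - c)) := (IsUnit.mk0 _ hz').map _
    have hinv : Ring.inverse (algebraMap ℂ A (z - c)) = algebraMap ℂ A (z - c)⁻¹ := by
      rw [← hunit.mul_right_inj, Ring.mul_inverse_cancel _ hunit, ← map_mul,
        mul_inv_cancel₀ hz', map_one]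
    simp only [resolvent]
    rw [hmul, Ring.mul_inverse_rev' (Algebra.commute_algebraMap_left _ _), hinv, ← Algebra.commutes,
      ← Algebra.smul_def]
  rw [circleIntegral.integral_congr hr.le hres,
    circleIntegral_sub_center_inv_smul_comp_inv (fun w => Ring.inverse (1 - w • d)) c hr.ne']
  simpa using hg.circleIntegral_sub_inv_smul (mem_ball_self (inv_pos.2 hr))

theorem ContinuousLinearMap.circleIntegral_comp_comm {E F : Type*} [NormedAddCommGroup E]
    [NormedSpace ℂ E] [CompleteSpace E] [NormedAddCommGroup F] [NormedSpace ℂ F] [CompleteSpace F]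
    (L : E →L[ℂ] F) {f : ℂ → E} {c : ℂ} {r : ℝ} (hf : CircleIntegrable f c r) :
    (∮ z in C(c, r), L (f z)) = L (∮ z in C(c, r), f z) := by
  simp only [circleIntegral, ← map_smul]
  exact L.intervalIntegral_comp_comm hf.out

theorem circleIntegral_log_smul_resolvent_sq {A : Type*} [NormedRing A] [NormedAlgebra ℂ A]
    [CompleteSpace A] {b : A} {c : ℂ} {r : ℝ} (h : ‖b - algebraMap ℂ A c‖ < r)
    (hc : closedBall c r ⊆ slitPlane) :
    (∮ z in C(c, r), Complex.log z • resolvent b z ^ 2) = (2 * π * I : ℂ) • Ring.inverse b := by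
  have hr : 0 < r := (norm_nonneg _).trans_lt h
  have hsub := sphere_subset_closedBall.trans hc
  have hres : ∀ z ∈ sphere c r, z ∈ resolventSet ℂ b := fun z hz =>
    mem_resolventSet_of_norm_sub_algebraMap_lt (by rwa [mem_sphere_iff_norm.1 hz])
  have h0 : ∀ z ∈ closedBall c r, z ≠ 0 := fun z hz => slitPlane_ne_zero (hc hz)
  have hb : IsUnit b := by
    have hcr : r < ‖(0 : ℂ) - c‖ := by
      by_contra! hle
      exact h0 0 (by rwa [mem_closedBall, dist_eq_norm]) rfl
    simpa [spectrum.mem_resolventSet_iff] using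
      mem_resolventSet_of_norm_sub_algebraMap_lt (h.trans hcr)
  have hRc : ContinuousOn (resolvent b) (sphere c r) := fun z hz =>
    (spectrum.hasDerivAt_resolvent_const_left (hres z hz)).continuousAt.continuousWithinAt
  have hlog : ContinuousOn Complex.log (sphere c r) := fun z hz =>
    (continuousAt_clog (hsub hz)).continuousWithinAt
  have hinv : ContinuousOn (fun z : ℂ => z⁻¹) (sphere c r) :=
    continuousOn_inv₀.mono fun z hz => h0 z (sphere_subset_closedBall hz)
  have hparts :
      (∮ z in C(c, r), (z⁻¹ • resolvent b z - Complex.log z • resolvent b z ^ 2)) = 0 := by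
    refine circleIntegral.integral_eq_zero_of_hasDerivWithinAt hr.le
      (f := fun z => Complex.log z • resolvent b z) fun z hz => ?_
    convert! ((hasDerivAt_log (hsub hz)).smul
      (spectrum.hasDerivAt_resolvent_const_left (hres z hz))).hasDerivWithinAt using 1
    rw [smul_neg]
    abel
  have hint : CircleIntegrable (fun z => z⁻¹ • resolvent b z) c r :=
    (hinv.smul hRc).circleIntegrable hr.le
  have hint_log : CircleIntegrable (fun z => Complex.log z • resolvent b z ^ 2) c r :=
    (hlog.smul (hRc.pow 2)).circleIntegrable hr.le
  rw [circleIntegral.integral_sub hint hint_log, sub_eq_zero] at hparts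
  have hfrac : Set.EqOn (fun z => z⁻¹ • resolvent b z)
      (fun z => ContinuousLinearMap.mul ℂ A (Ring.inverse b) (resolvent b z - z⁻¹ • 1))
      (sphere c r) := by
    intro z hz
    have hz0 := h0 z (sphere_subset_closedBall hz)
    have hcancel : (algebraMap ℂ A z - b) * resolvent b z = 1 :=
      Ring.mul_inverse_cancel _ (hres z hz)
    have hone : resolvent b z - z⁻¹ • (1 : A) = b * (z⁻¹ • resolvent b z) := by
      rw [← hcancel, sub_mul, ← Algebra.smul_def, smul_sub, inv_smul_smul₀ hz0, mul_smul_comm]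
      abel
    simp only [ContinuousLinearMap.mul_apply']
    rw [hone, Ring.inverse_mul_cancel_left _ _ hb]
  have hinv_one : ContinuousOn (fun z : ℂ => z⁻¹ • (1 : A)) (sphere c r) :=
    hinv.smul continuousOn_const
  have hint_sub : CircleIntegrable (fun z => resolvent b z - z⁻¹ • (1 : A)) c r :=
    (hRc.sub hinv_one).circleIntegrable hr.le
  have hcauchy : (∮ z in C(c, r), z⁻¹ • (1 : A)) = 0 :=
    DiffContOnCl.circleIntegral_eq_zero hr.le
      (DifferentiableOn.diffContOnCl_ball (U := closedBall c r)
        (fun z hz => ((differentiableAt_inv (h0 z hz)).smul_const _).differentiableWithinAt)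
        subset_rfl)
  rw [← hparts, circleIntegral.integral_congr hr.le hfrac,
    ContinuousLinearMap.circleIntegral_comp_comm _ hint_sub,
    circleIntegral.integral_sub (hRc.circleIntegrable hr.le) (hinv_one.circleIntegrable hr.le),
    circleIntegral_resolvent h, hcauchy]
  simp

/-- the key Dunford-integral computation
`(2πi)⁻¹ ∮ Log λ · (λ − a − κ)⁻² · a dλ = 1 − κ (a + κ)⁻¹`. -/
theorem dunford_integral_log_resolvent_sq_mul
    {A : Type*} [NormedRing A] [NormedAlgebra ℂ A] [CompleteSpace A]
    (κ : ℝ) (hκ : 0 < κ) (a : A) (r : ℝ) (har : ‖a‖ < r) (hrκ : r < κ) :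
    IsUnit (a + (κ : ℂ) • (1 : A)) ∧
    (2 * π * Complex.I)⁻¹ •
      (∮ lam in C((κ : ℂ), r),
        Complex.log lam •
          ((Ring.inverse (lam • (1 : A) - a - (κ : ℂ) • (1 : A))) ^ 2 * a)) =
      1 - (κ : ℂ) • Ring.inverse (a + (κ : ℂ) • (1 : A)) := by
  set b := a + (κ : ℂ) • (1 : A) with hb
  have hba : b - algebraMap ℂ A κ = a := by
    rw [hb, Algebra.algebraMap_eq_smul_one, add_sub_cancel_right]
  have h : ‖b - algebraMap ℂ A κ‖ < r := by rwa [hba]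
  have hr : 0 ≤ r := (norm_nonneg a).trans har.le
  have hunit : IsUnit b := by
    have hκ' : r < ‖(0 : ℂ) - κ‖ := by simpa [abs_of_pos hκ] using hrκ
    simpa [spectrum.mem_resolventSet_iff] using
      mem_resolventSet_of_norm_sub_algebraMap_lt (h.trans hκ')
  have hslit : closedBall (κ : ℂ) r ⊆ slitPlane := by
    intro z hz
    left
    have hre := (abs_re_le_norm (z - κ)).trans (mem_closedBall_iff_norm.1 hz)
    rw [sub_re, ofReal_re, abs_le] at hre
    linarith
  have hcont : ContinuousOn (fun z => Complex.log z • resolvent b z ^ 2) (sphere (κ : ℂ) r) := by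
    intro z hz
    have hres : z ∈ resolventSet ℂ b :=
      mem_resolventSet_of_norm_sub_algebraMap_lt (by rwa [mem_sphere_iff_norm.1 hz])
    exact ((continuousAt_clog (hslit (sphere_subset_closedBall hz))).smul
      ((spectrum.hasDerivAt_resolvent_const_left hres).continuousAt.pow 2)).continuousWithinAt
  have hintegrand : ∀ z : ℂ,
      Complex.log z • ((Ring.inverse (z • (1 : A) - a - (κ : ℂ) • (1 : A))) ^ 2 * a) =
        (ContinuousLinearMap.mul ℂ A).flip a (Complex.log z • resolvent b z ^ 2) := by
    intro z
    simp [resolvent, Algebra.algebraMap_eq_smul_one, hb, sub_sub]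
  refine ⟨hunit, ?_⟩
  simp only [hintegrand]
  rw [ContinuousLinearMap.circleIntegral_comp_comm _ (hcont.circleIntegrable hr),
    circleIntegral_log_smul_resolvent_sq h hslit, map_smul, inv_smul_smul₀ two_pi_I_ne_zero,
    ContinuousLinearMap.flip_apply, ContinuousLinearMap.mul_apply']
  conv_lhs => rw [← hba]
  rw [mul_sub, Ring.inverse_mul_cancel _ hunit, ← Algebra.commutes, ← Algebra.smul_def]
end

section
/- Let X be a complex Banach space, T > 0, and let {U(t,s)}_{−T ≤ t,s ≤ T} be an invertible evolution family on X with uniform bound ‖U(t,s)‖ ≤ K. Let Y be a complex Banach space continuously and densely embedded in X by an injective ι ∈ B(Y,X) with dense range, and suppose Y is U-invariant: for all t,s there is V(t,s) ∈ B(Y) with ι ∘ V(t,s) = U(t,s) ∘ ι. Let A(t) ∈ B(Y,X) for −T ≤ t ≤ T satisfy, for a fixed s ∈ [−T,T], every u ∈ Y and every t ∈ (−T,T): (i) the map τ ↦ U(τ,s)(ι u) is differentiable at t with derivative A(t)(V(t,s)u); (ii) commutation, A(t)(V(t,s)u) = U(t,s)(A(t)u); (iii) sup_{τ ∈ [−T,T]}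 ‖A(τ) ∘ V(τ,s)‖_{B(Y,X)} < ∞. Fix real κ and r with K < r < κ and define a(t,s) := (2πi)^{−1} ∮_{C(κ,r)} Log λ · (λI − U(t,s) − κI)^{−1} dλ ∈ B(X). Then for every u ∈ Y and t ∈ (−T,T), the map τ ↦ a(τ,s)(ι u) is weakly differentiable at t: there exists w ∈ X such that for every continuous linear functional φ on X the scalar function τ ↦ φ(a(τ,s)(ι u)) is differentiable at t with derivative φ(w), and the logarithm representation A(t)u = (I + κ U(s,t)) w holds. -/
open Complex Metric Real

section Auxiliary

open Filter Topology MeasureTheory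

theorem smul_one_sub_eq_smul {𝔸 : Type*} [Ring 𝔸] [Algebra ℂ 𝔸] {b : 𝔸} {μ : ℂ} (hμ : μ ≠ 0) :
    μ • (1 : 𝔸) - b = Units.mk0 μ hμ • (1 - μ⁻¹ • b) := by
  rw [Units.smul_def, Units.val_mk0, smul_sub, smul_inv_smul₀ hμ]

theorem norm_inv_smul_lt_one {𝔸 : Type*} [NormedRing 𝔸] [NormedAlgebra ℂ 𝔸] {b : 𝔸} {μ : ℂ}
    (hb : ‖b‖ < ‖μ‖) : ‖μ⁻¹ • b‖ < 1 := by
  rw [norm_smul, norm_inv, inv_mul_lt_iff₀ ((norm_nonneg b).trans_lt hb), mul_one]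
  exact hb

theorem isUnit_smul_one_sub {𝔸 : Type*} [NormedRing 𝔸] [NormedAlgebra ℂ 𝔸] [CompleteSpace 𝔸]
    {b : 𝔸} {μ : ℂ} (hb : ‖b‖ < ‖μ‖) : IsUnit (μ • (1 : 𝔸) - b) := by
  rw [smul_one_sub_eq_smul (norm_pos_iff.1 ((norm_nonneg b).trans_lt hb))]
  exact (isUnit_one_sub_of_norm_lt_one (norm_inv_smul_lt_one hb)).smul _

/-- The resolvent of a bounded element is the sum of its Neumann series. -/
theorem hasSum_inverse_smul_one_sub {𝔸 : Type*} [NormedRing 𝔸] [NormedAlgebra ℂ 𝔸]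
    [CompleteSpace 𝔸] {b : 𝔸} {μ : ℂ} (hb : ‖b‖ < ‖μ‖) :
    HasSum (fun n : ℕ => (1 / μ ^ (n + 1)) • b ^ n) (Ring.inverse (μ • (1 : 𝔸) - b)) := by
  have hμ : μ ≠ 0 := norm_pos_iff.1 ((norm_nonneg b).trans_lt hb)
  have hlt := norm_inv_smul_lt_one hb
  obtain ⟨v, hv⟩ := isUnit_one_sub_of_norm_lt_one hlt
  have hinv : Ring.inverse (μ • (1 : 𝔸) - b) = μ⁻¹ • Ring.inverse (1 - μ⁻¹ • b) := by
    rw [smul_one_sub_eq_smul hμ, ← hv, ← Units.val_smul, Ring.inverse_unit, Ring.inverse_unit,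
      Units.smul_inv, Units.val_smul, Units.smul_def, Units.val_inv_eq_inv_val, Units.val_mk0]
  rw [hinv]
  refine ((hasSum_geom_series_inverse _ hlt).const_smul μ⁻¹).congr_fun ?_
  intro n
  rw [smul_pow, smul_smul, one_div, inv_pow, pow_succ, mul_inv, mul_comm]

/-- The holomorphic functional calculus on a circle enclosing the spectrum is given by the
power series with the Cauchy coefficients of the symbol. -/
theorem hasSum_circleIntegral_smul_inverse {𝔸 : Type*} [NormedRing 𝔸] [NormedAlgebra ℂ 𝔸]
    [CompleteSpace 𝔸] {b : 𝔸} {c : ℂ} {r : ℝ} (hb : ‖b‖ < r) {f : ℂ → ℂ}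
    (hf : CircleIntegrable f c r) :
    HasSum (fun n : ℕ => (∮ z in C(c, r), (1 / (z - c) ^ (n + 1)) • f z) • b ^ n)
      (∮ z in C(c, r), f z • Ring.inverse ((z - c) • (1 : 𝔸) - b)) := by
  have hr : 0 < r := (norm_nonneg b).trans_lt hb
  have hq0 : 0 ≤ ‖b‖ / r := by positivity
  have hq1 : ‖b‖ / r < 1 := (div_lt_one hr).2 hb
  set M : ℝ := max ‖(1 : 𝔸)‖ 1
  have hpow : ∀ n : ℕ, ‖b ^ n‖ ≤ M * ‖b‖ ^ n := by
    intro n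
    rcases n.eq_zero_or_pos with rfl | hn
    · simp [M]
    · exact (norm_pow_le' b hn).trans
        (le_mul_of_one_le_left (by positivity) (le_max_right _ _))
  simp_rw [← circleIntegral.integral_smul_const]
  refine intervalIntegral.hasSum_integral_of_dominated_convergence
      (fun n θ => ‖f (circleMap c r θ)‖ * (M * (‖b‖ / r) ^ n)) (fun n => ?_) (fun n => ?_) ?_ ?_ ?_
  · simp only [deriv_circleMap]
    have hpole : Measurable fun θ : ℝ => 1 / (circleMap c r θ - c) ^ (n + 1) := by fun_prop
    exact AEStronglyMeasurable.smul (Measurable.aestronglyMeasurable (by fun_prop))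
      ((hpole.aestronglyMeasurable.smul hf.def'.1).smul aestronglyMeasurable_const)
  · refine Eventually.of_forall fun θ _ => ?_
    have h1 : ‖deriv (circleMap c r) θ • ((1 / (circleMap c r θ - c) ^ (n + 1)) •
        f (circleMap c r θ)) • b ^ n‖ = ‖f (circleMap c r θ)‖ * (‖b ^ n‖ / r ^ n) := by
      simp [norm_smul, abs_of_pos hr]
      field_simp
      ring
    rw [h1, div_pow, ← mul_div_assoc M]
    exact mul_le_mul_of_nonneg_left (div_le_div_of_nonneg_right (hpow n) (by positivity))
      (norm_nonneg _)
  · exact Eventually.of_forall fun _ _ =>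
      ((summable_geometric_of_lt_one hq0 hq1).mul_left _).mul_left _
  · simpa only [tsum_mul_left, tsum_geometric_of_lt_one hq0 hq1] using
      hf.norm.mul_continuousOn continuousOn_const
  · refine Eventually.of_forall fun θ _ => HasSum.const_smul _ ?_
    have hlt : ‖b‖ < ‖circleMap c r θ - c‖ := by simpa [abs_of_pos hr] using hb
    refine ((hasSum_inverse_smul_one_sub hlt).const_smul (f (circleMap c r θ))).congr_fun ?_
    intro n
    simp only [smul_smul, smul_eq_mul, mul_comm]

theorem closedBall_ofReal_subset_slitPlane {κ r : ℝ} (hrκ : r < κ) :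
    closedBall (κ : ℂ) r ⊆ slitPlane := by
  intro z hz
  rw [mem_closedBall, Complex.dist_eq] at hz
  have h := (abs_re_le_norm (z - κ)).trans hz
  rw [sub_re, ofReal_re, abs_le] at h
  exact Or.inl (by linarith [h.1])

/-- The positive-order Cauchy coefficients of the principal logarithm about `κ > 0`. -/
theorem circleIntegral_log_coeff {κ r : ℝ} (hr : 0 < r) (hrκ : r < κ) (n : ℕ) :
    (∮ z in C((κ : ℂ), r), (1 / (z - κ) ^ (n + 1 + 1)) • Complex.log z) =
      (2 * π * I) * ((-1) ^ n / ((n + 1) * (κ : ℂ) ^ (n + 1))) := by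
  have hsub := closedBall_ofReal_subset_slitPlane hrκ
  have hdiff : DifferentiableOn ℂ Complex.log (closedBall (κ : ℂ) r) := fun z hz =>
    (Complex.differentiableAt_log (hsub hz)).differentiableWithinAt
  have hκ : (κ : ℂ) ∈ slitPlane := hsub (mem_closedBall_self hr.le)
  rw [hdiff.circleIntegral_one_div_sub_center_pow_smul hr, iteratedDeriv_succ_log hκ,
    Nat.factorial_succ, smul_eq_mul, show (-(n : ℤ) - 1) = -((n + 1 : ℕ) : ℤ) by push_cast; ring,
    zpow_neg, zpow_natCast]
  have hfac : (n.factorial : ℂ) ≠ 0 := by exact_mod_cast n.factorial_ne_zero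
  have hκ0 : (κ : ℂ) ≠ 0 := slitPlane_ne_zero hκ
  push_cast
  field_simp

/-- Product rule for a strongly continuous, locally bounded operator family. -/
theorem hasDerivAt_clm_apply_of_strong {X : Type*} [NormedAddCommGroup X] [NormedSpace ℂ X]
    {P : ℝ → X →L[ℂ] X} {f : ℝ → X} {f' g' : X} {t K : ℝ}
    (hP : ∀ᶠ τ in 𝓝 t, ‖P τ‖ ≤ K) (hPc : ∀ x, Tendsto (fun τ => P τ x) (𝓝 t) (𝓝 (P t x)))
    (hf : HasDerivAt f f' t) (hg : HasDerivAt (fun τ => P τ (f t)) g' t) :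
    HasDerivAt (fun τ => P τ (f τ)) (P t f' + g') t := by
  have hmain : HasDerivAt (fun τ => P τ (f τ - f t)) (P t f') t := by
    rw [hasDerivAt_iff_tendsto_slope] at hf ⊢
    have hbd : Tendsto (fun τ => P τ (slope f t τ - f')) (𝓝[≠] t) (𝓝 0) := by
      have h0 : Tendsto (fun τ => K * ‖slope f t τ - f'‖) (𝓝[≠] t) (𝓝 0) := by
        simpa using (tendsto_iff_norm_sub_tendsto_zero.1 hf).const_mul K
      refine squeeze_zero_norm' ?_ h0
      filter_upwards [hP.filter_mono nhdsWithin_le_nhds] with τ hτ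
      exact (P τ).le_of_opNorm_le hτ _
    have hsum := hbd.add ((hPc f').mono_left nhdsWithin_le_nhds)
    rw [zero_add] at hsum
    refine hsum.congr fun τ => ?_
    rw [← map_add, sub_add_cancel, slope_def_module, slope_def_module, sub_self, map_zero,
      sub_zero, ContinuousLinearMap.map_smul_of_tower]
  refine (hmain.add hg).congr_of_eventuallyEq (Eventually.of_forall fun τ => ?_)
  simp

/-- Powers of a strongly differentiable operator family whose derivative commutes with it. -/
theorem hasDerivAt_pow_apply {X Y : Type*} [NormedAddCommGroup X] [NormedSpace ℂ X]
    [NormedAddCommGroup Y] [NormedSpace ℂ Y] {P : ℝ → X →L[ℂ] X} {t K : ℝ}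
    (hP : ∀ᶠ τ in 𝓝 t, ‖P τ‖ ≤ K) (hPc : ∀ x, Tendsto (fun τ => P τ x) (𝓝 t) (𝓝 (P t x)))
    {ι A : Y →L[ℂ] X} {V : Y →L[ℂ] Y} (hV : ι.comp V = (P t).comp ι)
    (hder : ∀ v, HasDerivAt (fun τ => P τ (ι v)) (A (V v)) t)
    (hcomm : ∀ v, A (V v) = P t (A v)) (u : Y) (n : ℕ) :
    HasDerivAt (fun τ => (P τ ^ n) (ι u)) ((n : ℂ) • (P t ^ n) (A u)) t := by
  have hι : ∀ n : ℕ, (P t ^ n) (ι u) = ι ((V ^ n) u) := by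
    intro n
    induction n with
    | zero => simp
    | succ n ih =>
      rw [pow_succ', pow_succ', mul_apply_eq_comp, mul_apply_eq_comp, ih]
      exact (DFunLike.congr_fun hV _).symm
  have hA : ∀ n : ℕ, A ((V ^ n) u) = (P t ^ n) (A u) := by
    intro n
    induction n with
    | zero => simp
    | succ n ih =>
      rw [pow_succ', pow_succ', mul_apply_eq_comp, mul_apply_eq_comp,
        hcomm, ih]
  induction n with
  | zero => simpa using hasDerivAt_const t (ι u)
  | succ n ih =>
    have hg : HasDerivAt (fun τ => P τ ((P t ^ n) (ι u))) (A (V ((V ^ n) u))) t := by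
      rw [hι]
      exact hder _
    convert! hasDerivAt_clm_apply_of_strong hP hPc ih hg using 1
    · funext τ
      rw [pow_succ', mul_apply_eq_comp]
    · rw [hcomm, hA, map_smul, pow_succ', mul_apply_eq_comp, Nat.cast_succ, add_smul,
        one_smul]

/-- Mercator series for the logarithm of `κ + b` given by the holomorphic functional calculus. -/
theorem hasSum_log_apply {X : Type*} [NormedAddCommGroup X] [NormedSpace ℂ X] [CompleteSpace X]
    {b : X →L[ℂ] X} {κ r : ℝ} (hb : ‖b‖ < r) (hrκ : r < κ) (x : X) :
    HasSum (fun n : ℕ => ((-1) ^ n / ((n + 1) * (κ : ℂ) ^ (n + 1))) • (b ^ (n + 1)) x)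
      (((2 * π * Complex.I)⁻¹ • ∮ lam in C((κ : ℂ), r),
        Complex.log lam • Ring.inverse (lam • (1 : X →L[ℂ] X) - b - (κ : ℂ) • 1)) x -
        Complex.log κ • x) := by
  have hr : 0 < r := (norm_nonneg b).trans_lt hb
  have hdiff : DifferentiableOn ℂ Complex.log (closedBall (κ : ℂ) r) := fun z hz =>
    (Complex.differentiableAt_log
      (closedBall_ofReal_subset_slitPlane hrκ hz)).differentiableWithinAt
  have hint : CircleIntegrable Complex.log κ r :=
    (hdiff.continuousOn.mono sphere_subset_closedBall).circleIntegrable hr.le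
  have hlam : ∀ lam : ℂ, lam • (1 : X →L[ℂ] X) - b - (κ : ℂ) • 1 = (lam - κ) • 1 - b := by
    intro lam
    rw [sub_smul, sub_right_comm]
  simp_rw [hlam]
  have hsum := ((hasSum_circleIntegral_smul_inverse hb hint).const_smul
    (2 * π * Complex.I)⁻¹).mapL (ContinuousLinearMap.apply ℂ X x)
  rw [← hasSum_nat_add_iff' 1] at hsum
  have h0 : (∮ z in C((κ : ℂ), r), (1 / (z - κ) ^ (0 + 1)) • Complex.log z) =
      (2 * π * Complex.I) * Complex.log κ := by
    simpa using hdiff.circleIntegral_one_div_sub_center_pow_smul hr 0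
  convert! hsum using 1
  · funext n
    simp only [circleIntegral_log_coeff hr hrκ, ContinuousLinearMap.apply_apply,
      smul_apply, smul_smul]
    rw [inv_mul_cancel_left₀ two_pi_I_ne_zero]
  · simp only [Finset.sum_range_one, h0, ContinuousLinearMap.apply_apply,
      smul_apply, smul_smul, pow_zero, one_apply_eq_self]
    rw [inv_mul_cancel_left₀ two_pi_I_ne_zero]

/-- The alternating geometric series `∑ (-1) ^ n κ⁻ⁿ⁻¹ bⁿ⁺¹` inverts `1 + κ b⁻¹`. -/
theorem tsum_add_smul_eq_of_leftInverse {X : Type*} [NormedAddCommGroup X] [NormedSpace ℂ X]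
    [CompleteSpace X] {b b' : X →L[ℂ] X} {κ : ℝ} (hb : ‖b‖ < κ)
    (hinv : b'.comp b = ContinuousLinearMap.id ℂ X) (x : X) :
    (∑' n : ℕ, ((-1) ^ n / (κ : ℂ) ^ (n + 1)) • (b ^ (n + 1)) x) +
      (κ : ℂ) • b' (∑' n : ℕ, ((-1) ^ n / (κ : ℂ) ^ (n + 1)) • (b ^ (n + 1)) x) = x := by
  have hκ : 0 < κ := (norm_nonneg b).trans_lt hb
  have hκ0 : (κ : ℂ) ≠ 0 := by exact_mod_cast hκ.ne'
  have hlt : ‖b‖ < ‖(-κ : ℂ)‖ := by simpa [abs_of_pos hκ] using hb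
  have hsum := hasSum_inverse_smul_one_sub hlt
  have hunit : IsUnit ((-κ : ℂ) • (1 : X →L[ℂ] X) - b) :=
    isUnit_smul_one_sub hlt
  set R := Ring.inverse ((-κ : ℂ) • (1 : X →L[ℂ] X) - b)
  have hR : (-κ : ℂ) • R x - b (R x) = x := by
    exact DFunLike.congr_fun (Ring.mul_inverse_cancel _ hunit) x
  have htsum : HasSum (fun n : ℕ => ((-1) ^ n / (κ : ℂ) ^ (n + 1)) • (b ^ (n + 1)) x)
      (-b (R x)) := by
    refine ((hsum.mapL (ContinuousLinearMap.apply ℂ X x)).mapL (-b)).congr_fun fun n => ?_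
    rw [ContinuousLinearMap.apply_apply, smul_apply, map_smul,
      neg_apply, ← mul_apply_eq_comp, ← pow_succ', smul_neg,
      ← neg_smul, neg_pow (κ : ℂ)]
    congr 1
    field_simp
    rw [pow_succ, mul_neg_one, mul_neg, ← mul_pow]
    simp
  have hb' : b' (b (R x)) = R x := DFunLike.congr_fun hinv (R x)
  rw [htsum.tsum_eq, map_neg, hb']
  nth_rewrite 3 [← hR]
  module

end Auxiliary

/-- logarithm representation of pre-infinitesimal generators:
`A(t) u = (I + κ U(s,t)) ∂_t Log (U(t,s) + κ I) u` (the derivative taken weakly). -/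
theorem logarithm_representation_of_pre_infinitesimal_generator
    {X : Type*} [NormedAddCommGroup X] [NormedSpace ℂ X] [CompleteSpace X]
    {Y : Type*} [NormedAddCommGroup Y] [NormedSpace ℂ Y] [CompleteSpace Y]
    (T K : ℝ) (hT : 0 < T)
    (U : ℝ → ℝ → X →L[ℂ] X)
    (hcont : ∀ x : X, ContinuousOn (fun p : ℝ × ℝ => U p.1 p.2 x)
      (Set.Icc (-T) T ×ˢ Set.Icc (-T) T))
    (hsg : ∀ t ∈ Set.Icc (-T) T, ∀ r ∈ Set.Icc (-T) T, ∀ s ∈ Set.Icc (-T) T,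
      (U t r).comp (U r s) = U t s)
    (hid : ∀ s ∈ Set.Icc (-T) T, U s s = ContinuousLinearMap.id ℂ X)
    (hinv : ∀ t ∈ Set.Icc (-T) T, ∀ s ∈ Set.Icc (-T) T,
      (U s t).comp (U t s) = ContinuousLinearMap.id ℂ X)
    (hbound : ∀ t ∈ Set.Icc (-T) T, ∀ s ∈ Set.Icc (-T) T, ‖U t s‖ ≤ K)
    -- `Y` densely and continuously embedded in `X`, invariant under the family
    (ι : Y →L[ℂ] X) (hι : Function.Injective ι) (hdense : DenseRange ι)
    (V : ℝ → ℝ → Y →L[ℂ] Y)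
    (hV : ∀ t ∈ Set.Icc (-T) T, ∀ s ∈ Set.Icc (-T) T,
      ι.comp (V t s) = (U t s).comp ι)
    -- the pre-infinitesimal generator
    (A : ℝ → (Y →L[ℂ] X)) (s : ℝ) (hs : s ∈ Set.Icc (-T) T)
    (hder : ∀ u : Y, ∀ t ∈ Set.Ioo (-T) T,
      HasDerivAt (fun τ : ℝ => U τ s (ι u)) (A t (V t s u)) t)
    (hcomm : ∀ u : Y, ∀ t ∈ Set.Ioo (-T) T, A t (V t s u) = U t s (A t u))
    (hAbound : ∃ C : ℝ, ∀ τ ∈ Set.Icc (-T) T, ‖(A τ).comp (V τ s)‖ ≤ C)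
    -- the logarithm `a(t,s) = Log (U(t,s) + κ I)` via the Dunford integral
    (κ r : ℝ) (hKr : K < r) (hrκ : r < κ)
    (a : ℝ → X →L[ℂ] X)
    (ha : ∀ t : ℝ, a t = (2 * π * Complex.I)⁻¹ •
      ∮ lam in C((κ : ℂ), r),
        Complex.log lam • Ring.inverse (lam • (1 : X →L[ℂ] X) - U t s - (κ : ℂ) • 1)) :
    ∀ u : Y, ∀ t ∈ Set.Ioo (-T) T,
      ∃ w : X,
        (∀ φ : X →L[ℂ] ℂ,
          HasDerivAt (fun τ : ℝ => φ (a τ (ι u))) (φ w) t) ∧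
        A t u = w + (κ : ℂ) • U s t w := by
  intro u t ht
  obtain ⟨C, hC⟩ := hAbound
  have htI := Set.Ioo_subset_Icc_self ht
  have hK : 0 ≤ K := (norm_nonneg _).trans (hbound t htI s hs)
  have hr : 0 < r := hK.trans_lt hKr
  have hκ : 0 < κ := hr.trans hrκ
  have hpow_bound : ∀ n : ℕ, ∀ τ ∈ Set.Ioo (-T) T, ‖U τ s ^ n‖ ≤ K ^ n := by
    intro n τ hτ
    have hU := hbound τ (Set.Ioo_subset_Icc_self hτ) s hs
    rcases n.eq_zero_or_pos with rfl | hn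
    · rw [pow_zero, pow_zero]
      exact ContinuousLinearMap.norm_id_le
    · exact (norm_pow_le' _ hn).trans (pow_le_pow_left₀ (norm_nonneg _) hU n)
  -- differentiate the powers on the embedded space
  have hpow_deriv : ∀ n : ℕ, ∀ τ ∈ Set.Ioo (-T) T,
      HasDerivAt (fun σ => (U σ s ^ n) (ι u)) ((n : ℂ) • (U τ s ^ n) (A τ u)) τ := by
    intro n τ hτ
    have hτI := Set.Ioo_subset_Icc_self hτ
    exact hasDerivAt_pow_apply
      (Filter.eventually_of_mem (Ioo_mem_nhds hτ.1 hτ.2) fun σ hσ =>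
        hbound σ (Set.Ioo_subset_Icc_self hσ) s hs)
      (fun x => ((hcont x).comp (by fun_prop : ContinuousOn (fun σ : ℝ => (σ, s)) _)
        (fun σ hσ => ⟨hσ, hs⟩)).continuousAt (Icc_mem_nhds hτ.1 hτ.2))
      (hV τ hτI s hs) (fun v => hder v τ hτ) (fun v => hcomm v τ hτ) u n
  -- expand the logarithm in powers of `U τ s`
  have hsum : ∀ τ ∈ Set.Ioo (-T) T, HasSum
      (fun n : ℕ => ((-1) ^ n / ((n + 1) * (κ : ℂ) ^ (n + 1))) • (U τ s ^ (n + 1)) (ι u))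
      (a τ (ι u) - Complex.log κ • ι u) := fun τ hτ => by
    rw [ha τ]
    exact hasSum_log_apply ((hbound τ (Set.Ioo_subset_Icc_self hτ) s hs).trans_lt hKr) hrκ _
  have hterm : ∀ n : ℕ, ∀ τ : ℝ,
      ((-1) ^ n / ((n + 1) * (κ : ℂ) ^ (n + 1))) • ((n + 1 : ℕ) : ℂ) • (U τ s ^ (n + 1)) (A τ u) =
        ((-1) ^ n / (κ : ℂ) ^ (n + 1)) • (U τ s ^ (n + 1)) (A τ u) := by
    intro n τ
    have hn : ((n : ℂ) + 1) ≠ 0 := by exact_mod_cast n.succ_ne_zero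
    have hκ0 : (κ : ℂ) ≠ 0 := by exact_mod_cast hκ.ne'
    rw [smul_smul]
    congr 1
    push_cast
    field_simp
  have hsummable : Summable fun n : ℕ => (K / κ) ^ n * (κ⁻¹ * (C * ‖u‖)) :=
    (summable_geometric_of_lt_one (by positivity)
      ((div_lt_one hκ).2 (hKr.trans hrκ))).mul_right _
  have hseries := hasDerivAt_tsum_of_isPreconnected hsummable isOpen_Ioo isPreconnected_Ioo
    (g := fun (n : ℕ) τ =>
      ((-1) ^ n / ((n + 1) * (κ : ℂ) ^ (n + 1))) • (U τ s ^ (n + 1)) (ι u))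
    (g' := fun (n : ℕ) τ => ((-1) ^ n / (κ : ℂ) ^ (n + 1)) • (U τ s ^ (n + 1)) (A τ u))
    (fun n τ hτ => by
      rw [← hterm]
      exact (hpow_deriv (n + 1) τ hτ).const_smul _)
    (fun n τ hτ => by
      have hA : ‖A τ (V τ s u)‖ ≤ C * ‖u‖ :=
        ((A τ).comp (V τ s)).le_of_opNorm_le (hC τ (Set.Ioo_subset_Icc_self hτ)) u
      have hUA : ‖(U τ s ^ (n + 1)) (A τ u)‖ ≤ K ^ n * (C * ‖u‖) := by
        rw [pow_succ, mul_apply_eq_comp, ← hcomm u τ hτ]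
        exact (ContinuousLinearMap.le_of_opNorm_le _ (hpow_bound n τ hτ) _).trans
          (mul_le_mul_of_nonneg_left hA (by positivity))
      have hcoeff : ‖(-1) ^ n / (κ : ℂ) ^ (n + 1)‖ = (κ ^ (n + 1))⁻¹ := by
        simp [abs_of_pos hκ]
      rw [norm_smul, hcoeff]
      calc (κ ^ (n + 1))⁻¹ * ‖(U τ s ^ (n + 1)) (A τ u)‖
          ≤ (κ ^ (n + 1))⁻¹ * (K ^ n * (C * ‖u‖)) :=
            mul_le_mul_of_nonneg_left hUA (by positivity)
        _ = (K / κ) ^ n * (κ⁻¹ * (C * ‖u‖)) := by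
            rw [div_pow, pow_succ, mul_inv]
            ring)
    ht (hsum t ht).summable ht
  have hderiv := (hseries.add_const (Complex.log κ • ι u)).congr_of_eventuallyEq
    (f₁ := fun τ => a τ (ι u)) (by
      filter_upwards [Ioo_mem_nhds ht.1 ht.2] with τ hτ
      rw [(hsum τ hτ).tsum_eq, sub_add_cancel])
  refine ⟨_, fun φ => (φ.restrictScalars ℝ).hasFDerivAt.comp_hasDerivAt t hderiv, ?_⟩
  exact (tsum_add_smul_eq_of_leftInverse
    (((hbound t htI s hs).trans_lt hKr).trans hrκ) (hinv t htI s hs) (A t u)).symm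
end

section
/- Let X be a complex Banach space, T > 0, and let {U(t,s)}_{−T ≤ t,s ≤ T} be an invertible evolution family on X with uniform bound ‖U(t,s)‖ ≤ K. Let Y be a complex Banach space continuously and densely embedded in X by an injective ι ∈ B(Y,X) with dense range, U-invariant via V(t,s) ∈ B(Y) with ι ∘ V(t,s) = U(t,s) ∘ ι. Let A(t) ∈ B(Y,X) satisfy for every u ∈ Y: (i) τ ↦ U(τ,s)(ι u) is differentiable at every t ∈ (−T,T) with derivative A(t)(V(t,s)u); (ii) A(t)(V(t,s)u) = U(t,s)(A(t)u); (iii) for every fixed t, τ ↦ U(t,τ)(ι u) is differentiable at every τ ∈ (−T,T) with derivative −U(t,τ)(A(τ)u); (iv) each A(t) is closed as an operator in X: if (u_n) ⊆ Y, ι(u_n) → x in X and A(t)u_n → y in X, then there is u ∈ Y with ι(u) = x and A(t)u = y; (v) there are operators W(t,τ) ∈ B(X) with W(t,τ)(ι u) = A(t)(V(t,τ)u) for all u ∈ Y and sup_{t,τ ∈ [−T,T]} ‖W(t,τ)‖ < ∞. Let f : [−T,T] → X be Hölder continuous: ‖f(t) − f(s)‖ ≤ C_H |t − s|^γ for some constant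 C_H and some 0 < γ ≤ 1. Then for every ξ ∈ Y and s ∈ [−T,T], the function u(t) := U(t,s)(ι ξ) + ∫_s^t U(t,τ) f(τ) dτ satisfies: u(s) = ι ξ; u(t) ∈ ι(Y) for every t, say u(t) = ι(v(t)) with v(t) ∈ Y; and for every t ∈ (−T,T), u is differentiable at t with u′(t) = A(t)v(t) + f(t). In particular the inhomogeneous abstract Cauchy problem ∂_t u = A(t)u + f(t), u(s) = ι ξ, has a classical solution for merely Hölder continuous f. -/
open Complex Metric Real Filter
open scoped Topology

/-- A locally bounded, strongly convergent family of operators maps a convergent family of vectors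
to a convergent family. -/
theorem tendsto_clm_apply_of_norm_le {α X Z : Type*} [NormedAddCommGroup X] [NormedSpace ℂ X]
    [NormedAddCommGroup Z] [NormedSpace ℂ Z] {l : Filter α} {F : α → X →L[ℂ] Z} {w : α → X}
    {x : X} {z : Z} {K : ℝ} (hK : ∀ᶠ a in l, ‖F a‖ ≤ K)
    (hF : Tendsto (fun a => F a x) l (𝓝 z)) (hw : Tendsto w l (𝓝 x)) :
    Tendsto (fun a => F a (w a)) l (𝓝 z) := by
  have h0 : Tendsto (fun a => F a (w a - x)) l (𝓝 0) := by
    have hw0 : Tendsto (fun a => K * ‖w a - x‖) l (𝓝 0) := by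
      simpa using ((hw.sub_const x).norm).const_mul K
    refine squeeze_zero_norm' ?_ hw0
    filter_upwards [hK] with a ha
    exact (F a).le_of_opNorm_le ha _
  simpa using h0.add hF

/-- Product rule for a locally bounded operator family that is only strongly differentiable. -/
theorem HasDerivAt.clm_apply_of_norm_le {X Z : Type*} [NormedAddCommGroup X] [NormedSpace ℂ X]
    [NormedAddCommGroup Z] [NormedSpace ℂ Z] {F : ℝ → X →L[ℂ] Z} {w : ℝ → X} {t K : ℝ}
    {a : Z} {b : X} (hK : ∀ᶠ τ in 𝓝 t, ‖F τ‖ ≤ K)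
    (hF : HasDerivAt (fun τ => F τ (w t)) a t) (hw : HasDerivAt w b t)
    (hb : ContinuousAt (fun τ => F τ b) t) :
    HasDerivAt (fun τ => F τ (w τ)) (a + F t b) t := by
  rw [hasDerivAt_iff_tendsto_slope] at hF hw ⊢
  have hlim := hF.add (tendsto_clm_apply_of_norm_le (hK.filter_mono nhdsWithin_le_nhds)
    (hb.tendsto.mono_left nhdsWithin_le_nhds) hw)
  refine hlim.congr fun τ => ?_
  have hsmul (r : ℝ) (y : X) : F τ (r • y) = r • F τ y :=
    ((F τ).restrictScalars ℝ).map_smul r y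
  simp only [slope, vsub_eq_sub, hsmul, map_sub, ← smul_add]
  congr 1
  abel

/-- A densely defined closed operator which is bounded for the ambient norm is everywhere
defined. -/
theorem surjective_of_closed_of_bound {X Y : Type*} [NormedAddCommGroup X] [NormedSpace ℂ X]
    [CompleteSpace X] [NormedAddCommGroup Y] [NormedSpace ℂ Y] {ι A : Y →L[ℂ] X}
    (hdense : DenseRange ι) (B : X →L[ℂ] X) (hB : ∀ u, B (ι u) = A u)
    (hclosed : ∀ (un : ℕ → Y) (x y : X), Tendsto (fun n => ι (un n)) atTop (𝓝 x) →
      Tendsto (fun n => A (un n)) atTop (𝓝 y) → ∃ u : Y, ι u = x ∧ A u = y) :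
    Function.Surjective ι := by
  intro x
  obtain ⟨xs, hxs, hlim⟩ := mem_closure_iff_seq_limit.mp (hdense x)
  choose un hun using hxs
  have hun' : Tendsto (fun n => ι (un n)) atTop (𝓝 x) := by simpa only [hun] using hlim
  obtain ⟨u, hu, -⟩ := hclosed un x (B x) hun' (by
    simpa only [Function.comp_def, hB] using (B.continuous.tendsto x).comp hun')
  exact ⟨u, hu⟩

/-- Hölder continuity on a set implies continuity there. -/
theorem continuousOn_of_norm_sub_le_rpow {X : Type*} [NormedAddCommGroup X] {f : ℝ → X}
    {S : Set ℝ} {C γ : ℝ} (hγ : 0 < γ)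
    (hf : ∀ t ∈ S, ∀ s ∈ S, ‖f t - f s‖ ≤ C * |t - s| ^ γ) : ContinuousOn f S := by
  intro s hs
  rw [ContinuousWithinAt, tendsto_iff_norm_sub_tendsto_zero]
  have hc : Continuous fun t : ℝ => C * |t - s| ^ γ :=
    continuous_const.mul ((continuous_id.sub continuous_const).abs.rpow_const
      fun _ => Or.inr hγ.le)
  have h0 : Tendsto (fun t : ℝ => C * |t - s| ^ γ) (𝓝[S] s) (𝓝 0) := by
    simpa [Real.zero_rpow hγ.ne'] using (hc.tendsto s).mono_left (nhdsWithin_le_nhds (s := S))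
  refine squeeze_zero' (Eventually.of_forall fun _ => norm_nonneg _) ?_ h0
  filter_upwards [self_mem_nhdsWithin] with t ht
  exact hf t ht s hs

/-- classical solvability of the inhomogeneous abstract Cauchy problem
`∂_t u = A(t) u + f(t)`, `u(s) = ι ξ`, for merely Hölder continuous `f`. -/
theorem inhomogeneous_cauchy_problem_holder
    {X : Type*} [NormedAddCommGroup X] [NormedSpace ℂ X] [CompleteSpace X]
    {Y : Type*} [NormedAddCommGroup Y] [NormedSpace ℂ Y] [CompleteSpace Y]
    (T K : ℝ) (hT : 0 < T)
    (U : ℝ → ℝ → X →L[ℂ] X)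
    (hcont : ∀ x : X, ContinuousOn (fun p : ℝ × ℝ => U p.1 p.2 x)
      (Set.Icc (-T) T ×ˢ Set.Icc (-T) T))
    (hsg : ∀ t ∈ Set.Icc (-T) T, ∀ r ∈ Set.Icc (-T) T, ∀ s ∈ Set.Icc (-T) T,
      (U t r).comp (U r s) = U t s)
    (hid : ∀ s ∈ Set.Icc (-T) T, U s s = ContinuousLinearMap.id ℂ X)
    (hinv : ∀ t ∈ Set.Icc (-T) T, ∀ s ∈ Set.Icc (-T) T,
      (U s t).comp (U t s) = ContinuousLinearMap.id ℂ X)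
    (hbound : ∀ t ∈ Set.Icc (-T) T, ∀ s ∈ Set.Icc (-T) T, ‖U t s‖ ≤ K)
    -- `Y` densely and continuously embedded in `X`, invariant under the family
    (ι : Y →L[ℂ] X) (hι : Function.Injective ι) (hdense : DenseRange ι)
    (V : ℝ → ℝ → Y →L[ℂ] Y)
    (hV : ∀ t ∈ Set.Icc (-T) T, ∀ s ∈ Set.Icc (-T) T,
      ι.comp (V t s) = (U t s).comp ι)
    (A : ℝ → (Y →L[ℂ] X))
    -- (i) differentiability in the first variable
    (hder : ∀ u : Y, ∀ s ∈ Set.Icc (-T) T, ∀ t ∈ Set.Ioo (-T) T,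
      HasDerivAt (fun τ : ℝ => U τ s (ι u)) (A t (V t s u)) t)
    -- (ii) commutation
    (hcomm : ∀ u : Y, ∀ s ∈ Set.Icc (-T) T, ∀ t ∈ Set.Ioo (-T) T,
      A t (V t s u) = U t s (A t u))
    -- (iii) differentiability in the second variable
    (hder2 : ∀ u : Y, ∀ t ∈ Set.Icc (-T) T, ∀ τ ∈ Set.Ioo (-T) T,
      HasDerivAt (fun σ : ℝ => U t σ (ι u)) (-(U t τ (A τ u))) τ)
    -- (iv) each `A(t)` is closed as an operator in `X`
    (hclosed : ∀ t ∈ Set.Icc (-T) T, ∀ (un : ℕ → Y) (x y : X),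
      Tendsto (fun n => ι (un n)) atTop (nhds x) →
      Tendsto (fun n => A t (un n)) atTop (nhds y) →
      ∃ u : Y, ι u = x ∧ A t u = y)
    -- (v) uniformly bounded extensions of `A(t) V(t,τ)`
    (W : ℝ → ℝ → X →L[ℂ] X)
    (hW : ∀ t ∈ Set.Icc (-T) T, ∀ τ ∈ Set.Icc (-T) T, ∀ u : Y,
      W t τ (ι u) = A t (V t τ u))
    (hWbound : ∃ C : ℝ, ∀ t ∈ Set.Icc (-T) T, ∀ τ ∈ Set.Icc (-T) T, ‖W t τ‖ ≤ C)
    -- Hölder continuous inhomogeneity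
    (f : ℝ → X) (C_H γ : ℝ) (hγ0 : 0 < γ) (hγ1 : γ ≤ 1)
    (hf : ∀ t ∈ Set.Icc (-T) T, ∀ s ∈ Set.Icc (-T) T,
      ‖f t - f s‖ ≤ C_H * |t - s| ^ γ) :
    ∀ ξ : Y, ∀ s ∈ Set.Icc (-T) T, ∀ u : ℝ → X,
      (∀ t : ℝ, u t = U t s (ι ξ) + ∫ τ in s..t, U t τ (f τ)) →
      u s = ι ξ ∧
      ∃ v : ℝ → Y,
        (∀ t ∈ Set.Icc (-T) T, ι (v t) = u t) ∧
        ∀ t ∈ Set.Ioo (-T) T, HasDerivAt u (A t (v t) + f t) t := by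
  intro ξ s hs u hu
  have h0 : (0 : ℝ) ∈ Set.Icc (-T) T := ⟨by linarith, hT.le⟩
  have hVid : ∀ t ∈ Set.Icc (-T) T, ∀ y, V t t y = y := fun t ht y => hι <| by
    simpa [hid t ht] using DFunLike.congr_fun (hV t ht t ht) y
  have hsurj : Function.Surjective ι := surjective_of_closed_of_bound (A := A 0) hdense (W 0 0)
    (fun y => by rw [hW 0 h0 0 h0, hVid 0 h0]) (hclosed 0 h0)
  have hfc : ContinuousOn f (Set.Icc (-T) T) := continuousOn_of_norm_sub_le_rpow hγ0 hf
  have hUc : ∀ x, ContinuousOn (fun τ => U s τ x) (Set.Icc (-T) T) := fun x =>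
    (hcont x).comp (continuousOn_const.prodMk continuousOn_id) fun τ hτ => ⟨hs, hτ⟩
  have hUc' : ∀ x, ContinuousOn (fun τ => U τ s x) (Set.Icc (-T) T) := fun x =>
    (hcont x).comp (continuousOn_id.prodMk continuousOn_const) fun τ hτ => ⟨hτ, hs⟩
  set φ : ℝ → X := fun τ => U s τ (f τ) with hφ
  have hφc : ContinuousOn φ (Set.Icc (-T) T) := fun τ hτ =>
    tendsto_clm_apply_of_norm_le (eventually_nhdsWithin_of_forall fun σ hσ => hbound s hs σ hσ)
      (hUc (f τ) τ hτ) (hfc τ hτ)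
  have hφi : ∀ t ∈ Set.Icc (-T) T, IntervalIntegrable φ MeasureTheory.volume s t :=
    fun t ht => (hφc.mono (Set.uIcc_subset_Icc hs ht)).intervalIntegrable
  set w : ℝ → X := fun t => ι ξ + ∫ τ in s..t, φ τ with hw
  have huw : ∀ t ∈ Set.Icc (-T) T, u t = U t s (w t) := fun t ht => by
    rw [hu t, hw, map_add, ← ContinuousLinearMap.intervalIntegral_comp_comm _ (hφi t ht)]
    congr 1
    refine intervalIntegral.integral_congr fun τ hτ => ?_
    exact (DFunLike.congr_fun (hsg t ht s hs τ (Set.uIcc_subset_Icc hs ht hτ)) (f τ)).symm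
  refine ⟨by simp [hu, hid s hs], fun t => Function.surjInv hsurj (u t),
    fun t _ => Function.surjInv_eq hsurj _, fun t ht => ?_⟩
  have ht' := Set.Ioo_subset_Icc_self ht
  have hnhds : Set.Icc (-T) T ∈ 𝓝 t := Icc_mem_nhds ht.1 ht.2
  have hwd : HasDerivAt w (φ t) t :=
    (intervalIntegral.integral_hasDerivAt_right (hφi t ht')
      ((hφc.mono Set.Ioo_subset_Icc_self).stronglyMeasurableAtFilter isOpen_Ioo t ht)
      (hφc.continuousAt hnhds)).const_add _
  obtain ⟨η, hη⟩ := hsurj (w t)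
  have hv : V t s η = Function.surjInv hsurj (u t) := hι <| by
    rw [Function.surjInv_eq hsurj, huw t ht', ← hη]
    exact DFunLike.congr_fun (hV t ht' s hs) η
  have hUφ : U t s (φ t) = f t := DFunLike.congr_fun (hinv s hs t ht') (f t)
  have hprod := HasDerivAt.clm_apply_of_norm_le (F := fun τ => U τ s)
    (by filter_upwards [hnhds] with τ hτ using hbound τ hτ s hs)
    (hη ▸ hder η s hs t ht) hwd ((hUc' (φ t)).continuousAt hnhds)
  rw [hv, hUφ] at hprod
  refine hprod.congr_of_eventuallyEq ?_
  filter_upwards [hnhds] with τ hτ using huw τ hτ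
end
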